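/- For any numerical semigroup S minimally generated by at least two elements, the delta set Δ(S) is a finite nonempty set of positive integers. -/

import Mathlib

/-- The set of factorization lengths of `n` over the generators `gens`. -/
def lenSet (k : ℕ) (gens : Fin k → ℕ) (n : ℕ) : Set ℕ :=
  {l | ∃ x : Fin k → ℕ, n = ∑ i, x i * gens i ∧ l = ∑ i, x i}

/-- The delta set Δ(n): the set of gaps between consecutive factorization lengths of n. -/
def deltaSet (k : ℕ) (gens : Fin k → ℕ) (n : ℕ) : Set ℕ :=
  {d | 0 < d ∧ ∃ l, l ∈ lenSet k gens n ∧ l + d ∈ lenSet k gens n ∧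
    ∀ j, l < j → j < l + d → j ∉ lenSet k gens n}

/-- Trading `gens i` copies of `gens j` for `gens j` copies of `gens i` changes the length by
`gens j - gens i`. -/
lemma add_sub_mem_lenSet {k : ℕ} {gens x : Fin k → ℕ} {i j : Fin k}
    (hij : gens i < gens j) (hx : gens i ≤ x j) :
    ∑ t, x t + (gens j - gens i) ∈ lenSet k gens (∑ t, x t * gens t) := by
  have hne : i ≠ j := fun h => by simp [h] at hij
  obtain ⟨z, rfl⟩ : ∃ z : Fin k → ℕ, x = z + Pi.single j (gens i) := by
    refine ⟨x - Pi.single j (gens i), funext fun t => ?_⟩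
    rcases eq_or_ne t j with rfl | ht
    · simp [hx]
    · simp [ht]
  refine ⟨z + Pi.single i (gens j), ?_, ?_⟩
  · simp [mul_add, Finset.sum_add_distrib, Pi.single_apply, mul_comm]
  · simp [Finset.sum_add_distrib, add_assoc]
    omega

/-- If every coordinate of a factorization at a generator exceeding the least one `a` is less
than `a`, then no factorization is longer by more than `k * b`, with `b` bounding the generators. -/
lemma length_le_add_mul {k a b : ℕ} {gens x y : Fin k → ℕ} (ha : 0 < a)
    (hle : ∀ t, a ≤ gens t) (hb : ∀ t, gens t ≤ b) (hx : ∀ t, a < gens t → x t < a)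
    (hxy : ∑ t, x t * gens t = ∑ t, y t * gens t) :
    ∑ t, y t ≤ ∑ t, x t + k * b := by
  have lower : (∑ t, y t) * a ≤ ∑ t, y t * gens t := by
    rw [Finset.sum_mul]
    exact Finset.sum_le_sum fun t _ => Nat.mul_le_mul_left _ (hle t)
  have upper : ∑ t, x t * gens t ≤ ∑ t, (x t * a + b * a) := by
    refine Finset.sum_le_sum fun t _ => ?_
    rcases (hle t).eq_or_lt with h | h
    · rw [← h]; omega
    · have := Nat.mul_le_mul (hx t h).le (hb t)
      nlinarith
  rw [Finset.sum_add_distrib, ← Finset.sum_mul] at upper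
  simp only [Finset.sum_const, Finset.card_univ, Fintype.card_fin, smul_eq_mul] at upper
  refine Nat.le_of_mul_le_mul_right ?_ ha
  nlinarith

/-- Gaps between consecutive lengths are bounded uniformly in `n`. -/
lemma le_of_mem_deltaSet {k b n d : ℕ} {gens : Fin k → ℕ} {i : Fin k} (hi : 0 < gens i)
    (hle : ∀ t, gens i ≤ gens t) (hb : ∀ t, gens t ≤ b) (hd : d ∈ deltaSet k gens n) :
    d ≤ k * b + b := by
  obtain ⟨-, l, ⟨x, hxn, rfl⟩, ⟨y, hyn, hy⟩, hgap⟩ := hd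
  by_cases hx : ∀ t, gens i < gens t → x t < gens i
  · have := length_le_add_mul hi hle hb hx (hxn.symm.trans hyn)
    omega
  · push Not at hx
    obtain ⟨t, ht, hxt⟩ := hx
    by_contra! hlt
    have := hb t
    exact hgap _ (by omega) (by omega) (hxn ▸ add_sub_mem_lenSet ht hxt)

/-- An element with two distinct lengths has a nonempty delta set. -/
lemma deltaSet_nonempty {k n l m : ℕ} {gens : Fin k → ℕ} (hl : l ∈ lenSet k gens n)
    (hm : m ∈ lenSet k gens n) (hlm : l < m) : (deltaSet k gens n).Nonempty := by
  classical
  have hex : ∃ d, 0 < d ∧ l + d ∈ lenSet k gens n :=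
    ⟨m - l, by omega, by rwa [Nat.add_sub_cancel' hlm.le]⟩
  obtain ⟨hpos, hmem⟩ := Nat.find_spec hex
  refine ⟨Nat.find hex, hpos, l, hl, hmem, fun j hlj hj hjmem => ?_⟩
  refine Nat.find_min hex (m := j - l) (by omega) ⟨by omega, ?_⟩
  rwa [Nat.add_sub_cancel' hlj.le]

/-- For any numerical semigroup minimally generated by at least two elements, the
delta set Δ(S) is a finite nonempty set of positive integers. -/
theorem stmt_15 (k : ℕ) (hk : 2 ≤ k) (gens : Fin k → ℕ)
    (hmono : StrictMono gens)
    (hmin : ∀ i, gens i ∉ AddSubmonoid.closure (Set.range gens \ {gens i}))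
    (DS : Set ℕ)
    (hDS : DS = {d | ∃ n : ℕ, n ≠ 0 ∧ n ∈ AddSubmonoid.closure (Set.range gens) ∧
      d ∈ deltaSet k gens n}) :
    DS.Finite ∧ DS.Nonempty ∧ ∀ d ∈ DS, 0 < d := by
  subst hDS
  have hpos : ∀ i, 0 < gens i := fun i => Nat.pos_of_ne_zero fun h =>
    hmin i (h ▸ zero_mem _)
  let i : Fin k := ⟨0, by omega⟩
  let j : Fin k := ⟨1, by omega⟩
  have hij : gens i < gens j := hmono (Fin.mk_lt_mk.mpr one_pos)
  have hle : ∀ t, gens i ≤ gens t := fun t => hmono.monotone (Fin.mk_le_mk.mpr t.1.zero_le)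
  have hb : ∀ t, gens t ≤ ∑ s, gens s := fun t =>
    Finset.single_le_sum (fun _ _ => Nat.zero_le _) (Finset.mem_univ t)
  refine ⟨(Set.finite_Iic (k * (∑ s, gens s) + ∑ s, gens s)).subset ?_, ?_, ?_⟩
  · rintro d ⟨n, -, -, hd⟩
    exact le_of_mem_deltaSet (hpos i) hle hb hd
  · obtain ⟨d, hd⟩ : (deltaSet k gens (gens i * gens j)).Nonempty := by
      refine deltaSet_nonempty (l := gens i) (m := gens j)
        ⟨Pi.single j (gens i), ?_, ?_⟩ ⟨Pi.single i (gens j), ?_, ?_⟩ hij <;>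
      simp [Pi.single_apply, mul_comm]
    refine ⟨d, gens i * gens j, (Nat.mul_pos (hpos i) (hpos j)).ne', ?_, hd⟩
    rw [← smul_eq_mul]
    exact nsmul_mem (AddSubmonoid.subset_closure (Set.mem_range_self j)) _
  · rintro d ⟨n, -, -, hd⟩
    exact hd.1
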